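/- arXiv:1010.1549 — 3 statements merged into one kernel-verified Lean document; each statement's English description precedes it below -/
import Mathlib

section
/- Let f : [0,∞) → ℝ, let N ≥ 1, c > 0, λ > 0, n₁ ∈ ℕ, and let J be the finite-horizon reward. If t* ∈ [0,∞)^N is a global maximizer of J over [0,∞)^N, then the entries of t* are monotonically nondecreasing in the task index: for all j, k ∈ {1,…,N} with j ≤ k, t*_j ≤ t*_k. In particular, if the optimal policy processes tasks η_j and η_k with η_j > η_k, the later task receives at least as much time: t*_{η_j} ≥ t*_{η_k}. -/
/-- The finite-horizon reward of the dynamic decision making queue: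
`J t = (1/N) ( ∑_{ℓ=1}^N ( f (t ℓ) - c (n₁ - ℓ + 1) t ℓ ) - (c λ / 2) (∑ t ℓ)² )`,
where the index `ℓ : Fin N` represents task `ℓ + 1`. -/
noncomputable def finiteHorizonReward (f : ℝ → ℝ) (N : ℕ) (c lam : ℝ) (n₁ : ℕ)
    (t : Fin N → ℝ) : ℝ :=
  (1 / (N : ℝ)) *
    ((∑ ℓ : Fin N, (f (t ℓ) - c * ((n₁ : ℝ) - (((ℓ : ℕ) : ℝ) + 1) + 1) * t ℓ)) -
      (c * lam / 2) * (∑ ℓ : Fin N, t ℓ) ^ 2)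

/-- Exchanging the values of `t` at `j` and `k` changes the weighted sum `∑ i, g i * t i` by
`(g k - g j) * (t j - t k)`. -/
theorem sum_mul_comp_swap {ι : Type*} [Fintype ι] [DecidableEq ι] (g t : ι → ℝ) (j k : ι) :
    ∑ i, g i * t (Equiv.swap j k i) = ∑ i, g i * t i + (g k - g j) * (t j - t k) := by
  rcases eq_or_ne j k with rfl | hjk
  · simp
  rw [← sub_eq_iff_eq_add', ← Finset.sum_sub_distrib,
    ← Finset.sum_subset (Finset.subset_univ {j, k}), Finset.sum_pair hjk]
  · simp only [Equiv.swap_apply_left, Equiv.swap_apply_right]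
    ring
  · intro i _ hi
    simp only [Finset.mem_insert, Finset.mem_singleton, not_or] at hi
    rw [Equiv.swap_apply_of_ne_of_ne hi.1 hi.2, sub_self]

/-- Exchanging the durations of tasks `j` and `k` changes the reward only through the
position-dependent part of the linear penalty. -/
theorem finiteHorizonReward_comp_swap (f : ℝ → ℝ) (N : ℕ) (c lam : ℝ) (n₁ : ℕ)
    (t : Fin N → ℝ) (j k : Fin N) :
    finiteHorizonReward f N c lam n₁ (t ∘ Equiv.swap j k) =
      finiteHorizonReward f N c lam n₁ t +
        1 / (N : ℝ) * (c * (((k : ℕ) : ℝ) - ((j : ℕ) : ℝ)) * (t j - t k)) := by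
  simp only [finiteHorizonReward, Function.comp_apply, Finset.sum_sub_distrib]
  rw [Equiv.sum_comp (Equiv.swap j k) t, Equiv.sum_comp (Equiv.swap j k) fun i => f (t i),
    sum_mul_comp_swap (fun ℓ : Fin N => c * ((n₁ : ℝ) - (((ℓ : ℕ) : ℝ) + 1) + 1)) t j k]
  ring

/-- **Monotonicity of the optimal allocations (Lemma 2, part 1).**
If `t*` is a global maximizer of the finite-horizon reward `J` over `[0,∞)^N`,
then its entries are nondecreasing in the task index: `j ≤ k → t* j ≤ t* k`.
In particular, among processed tasks the later task receives at least as much time. -/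
theorem global_max_allocations_monotone
    (f : ℝ → ℝ) (N : ℕ) (hN : 1 ≤ N) (c lam : ℝ) (hc : 0 < c) (hlam : 0 < lam)
    (n₁ : ℕ) (tstar : Fin N → ℝ) (htstar : ∀ i, 0 ≤ tstar i)
    (hmax : ∀ t : Fin N → ℝ, (∀ i, 0 ≤ t i) →
      finiteHorizonReward f N c lam n₁ t ≤ finiteHorizonReward f N c lam n₁ tstar) :
    ∀ j k : Fin N, j ≤ k → tstar j ≤ tstar k := by
  intro j k hjk
  by_contra! hlt
  have hne : j < k := lt_of_le_of_ne hjk (by rintro rfl; exact lt_irrefl _ hlt)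
  have hidx : ((j : ℕ) : ℝ) < ((k : ℕ) : ℝ) := Nat.cast_lt.mpr hne
  have hNpos : (0 : ℝ) < N := Nat.cast_pos.mpr hN
  have hswap := hmax (tstar ∘ Equiv.swap j k) fun i => htstar _
  rw [finiteHorizonReward_comp_swap] at hswap
  have hgain : 0 < 1 / (N : ℝ) *
      (c * (((k : ℕ) : ℝ) - ((j : ℕ) : ℝ)) * (tstar j - tstar k)) :=
    mul_pos (one_div_pos.mpr hNpos)
      (mul_pos (mul_pos hc (sub_pos.mpr hidx)) (sub_pos.mpr hlt))
  linarith
end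

section
/- Let f : [0,∞) → ℝ be differentiable, let N ≥ 1, c > 0, λ > 0, n₁ ∈ ℕ, and let J be the finite-horizon reward. Fix a set of processed tasks T_processed = {η₁ < … < η_m} ⊆ {1,…,N}, and let V = {t ∈ [0,∞)^N : t_i = 0 for all i ∉ T_processed}. If t† ∈ V has t†_{η_k} > 0 for all k ∈ {1,…,m} and t† is a local maximum point of J restricted to V, then the first-order conditions hold: f'(t†_{η_k}) = c(n₁ − η_k + 1) + cλ·∑_{i=1}^m t†_{η_i} for every k ∈ {1,…,m}. -/
open Function in
/-- The partial derivative of the finite-horizon reward in the duration of task `k`. -/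
theorem hasDerivAt_finiteHorizonReward_update {f : ℝ → ℝ} {N : ℕ} (c lam : ℝ) (n₁ : ℕ)
    {t : Fin N → ℝ} {k : Fin N} {a : ℝ} (hf : HasDerivAt f a (t k)) :
    HasDerivAt (fun s => finiteHorizonReward f N c lam n₁ (update t k s))
      ((1 / (N : ℝ)) * ((a - c * ((n₁ : ℝ) - (((k : ℕ) : ℝ) + 1) + 1)) -
        c * lam * ∑ ℓ, t ℓ)) (t k) := by
  have hcoord (ℓ : Fin N) :
      HasDerivAt (fun s => update t k s ℓ) (if ℓ = k then 1 else 0) (t k) := by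
    split_ifs with h
    · subst h
      simpa using hasDerivAt_id' (t ℓ)
    · simpa [update_of_ne h] using hasDerivAt_const (t k) (t ℓ)
  have hterm (ℓ : Fin N) :
      HasDerivAt (fun s => f (update t k s ℓ) -
          c * ((n₁ : ℝ) - (((ℓ : ℕ) : ℝ) + 1) + 1) * update t k s ℓ)
        (if ℓ = k then a - c * ((n₁ : ℝ) - (((k : ℕ) : ℝ) + 1) + 1) else 0) (t k) := by
    split_ifs with h
    · subst h
      simpa using hf.fun_sub ((hasDerivAt_id' (t ℓ)).const_mul
        (c * ((n₁ : ℝ) - (((ℓ : ℕ) : ℝ) + 1) + 1)))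
    · simpa [update_of_ne h] using hasDerivAt_const (t k)
        (f (t ℓ) - c * ((n₁ : ℝ) - (((ℓ : ℕ) : ℝ) + 1) + 1) * t ℓ)
  have hsum := HasDerivAt.fun_sum (u := Finset.univ) fun ℓ _ => hcoord ℓ
  have hreward := HasDerivAt.fun_sum (u := Finset.univ) fun ℓ _ => hterm ℓ
  refine ((hreward.fun_sub ((hsum.fun_pow 2).const_mul (c * lam / 2))).const_mul
    (1 / (N : ℝ))).congr_deriv ?_
  simp only [Finset.sum_ite_eq', Finset.mem_univ, if_true, update_eq_self]
  ring

/-- **First-order conditions (Lemma 2, part 2).**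
Fix a set of processed tasks `P ⊆ {1,…,N}` and let
`V = {t ⪰ 0 : t i = 0 for all i ∉ P}`.  If `t†` lies in `V`, is strictly positive on
`P`, and is a local maximum point of `J` restricted to `V`, then for every `k ∈ P`
`f' (t† k) = c (n₁ - η_k + 1) + c λ ∑_{i ∈ P} t† i`, where `η_k = k + 1` is the task
number of the index `k`. -/
theorem first_order_conditions
    (f f' : ℝ → ℝ)
    (hder : ∀ t ∈ Set.Ici (0 : ℝ), HasDerivWithinAt f (f' t) (Set.Ici 0) t)
    (N : ℕ) (hN : 1 ≤ N) (c lam : ℝ) (hc : 0 < c) (hlam : 0 < lam) (n₁ : ℕ)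
    (P : Finset (Fin N))
    (tdag : Fin N → ℝ)
    (hmem : tdag ∈ {t : Fin N → ℝ | (∀ i, 0 ≤ t i) ∧ ∀ i ∉ P, t i = 0})
    (hpos : ∀ k ∈ P, 0 < tdag k)
    (hlocmax : IsLocalMaxOn (finiteHorizonReward f N c lam n₁)
      {t : Fin N → ℝ | (∀ i, 0 ≤ t i) ∧ ∀ i ∉ P, t i = 0} tdag) :
    ∀ k ∈ P, f' (tdag k) =
      c * ((n₁ : ℝ) - (((k : ℕ) : ℝ) + 1) + 1) + c * lam * ∑ i ∈ P, tdag i := by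
  obtain ⟨hnonneg, hzero⟩ := hmem
  intro k hk
  have hf : HasDerivAt f (f' (tdag k)) (tdag k) :=
    (hder _ (hnonneg k)).hasDerivAt (Ici_mem_nhds (hpos k hk))
  have hcurve : Filter.Tendsto (fun s => Function.update tdag k s) (nhds (tdag k))
      (nhdsWithin tdag {t : Fin N → ℝ | (∀ i, 0 ≤ t i) ∧ ∀ i ∉ P, t i = 0}) := by
    refine tendsto_nhdsWithin_iff.2 ⟨?_, ?_⟩
    · have h : Continuous fun s => Function.update tdag k s :=
        continuous_const.update k continuous_id
      simpa using h.tendsto (tdag k)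
    · filter_upwards [Ici_mem_nhds (hpos k hk)] with s hs
      refine ⟨fun i => ?_, fun i hi => ?_⟩
      · rcases eq_or_ne i k with rfl | h
        · simpa using hs
        · simpa [Function.update_of_ne h] using hnonneg i
      · rw [Function.update_of_ne (ne_of_mem_of_not_mem hk hi).symm]
        exact hzero i hi
  have hmax : IsLocalMax
      (fun s => finiteHorizonReward f N c lam n₁ (Function.update tdag k s)) (tdag k) := by
    filter_upwards [hcurve.eventually hlocmax] with s hs
    simpa using hs
  have hcrit := hmax.hasDerivAt_eq_zero
    (hasDerivAt_finiteHorizonReward_update c lam n₁ hf)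
  have hNpos : (1 / (N : ℝ)) ≠ 0 := one_div_ne_zero (Nat.cast_ne_zero.2 (by omega))
  have hsupp : ∑ i ∈ P, tdag i = ∑ i, tdag i :=
    Finset.sum_subset (Finset.subset_univ P) fun i _ hi => hzero i hi
  rw [hsupp]
  linarith [(mul_eq_zero.1 hcrit).resolve_left hNpos]
end

section
/- Let f : [0,∞) → ℝ be twice differentiable, let N ≥ 1, c > 0, λ > 0, n₁ ∈ ℕ, and let J be the finite-horizon reward. If t† ∈ [0,∞)^N is a local maximum point of J on [0,∞)^N and t†_k > 0 for some index k ∈ {1,…,N}, then the second-order necessary condition f''(t†_k) ≤ cλ holds. -/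
/-- The second-order necessary condition at a local maximum of a function of one real variable. -/
theorem IsLocalMax.second_deriv_nonpos {g g' : ℝ → ℝ} {a x : ℝ} (hmax : IsLocalMax g x)
    (hg : ∀ᶠ y in nhds x, HasDerivAt g (g' y) y) (hg' : HasDerivAt g' a x) : a ≤ 0 := by
  by_contra! ha
  have hd : deriv g =ᶠ[nhds x] g' := hg.mono fun y hy => hy.deriv
  have hdd : deriv (deriv g) x = a := hd.deriv_eq.trans hg'.deriv
  have hmin : IsLocalMin g x :=
    isLocalMin_of_deriv_deriv_pos (hdd ▸ ha) hmax.deriv_eq_zero hg.self_of_nhds.continuousAt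
  have hconst : g =ᶠ[nhds x] fun _ => g x := by
    filter_upwards [hmax, hmin] with y h₁ h₂ using le_antisymm h₁ h₂
  have hzero : deriv (deriv g) x = 0 := by
    rw [hconst.deriv.deriv_eq]
    simp
  exact ha.ne' (hdd.symm.trans hzero)

/-- The finite-horizon reward as a function of a single coordinate. -/
theorem finiteHorizonReward_update (f : ℝ → ℝ) (N : ℕ) (c lam : ℝ) (n₁ : ℕ)
    (t : Fin N → ℝ) (k : Fin N) :
    ∃ b C S : ℝ, ∀ s : ℝ, finiteHorizonReward f N c lam n₁ (Function.update t k s) =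
      (1 / (N : ℝ)) * (f s - b * s + C - (c * lam / 2) * (s + S) ^ 2) := by
  refine ⟨c * ((n₁ : ℝ) - (((k : ℕ) : ℝ) + 1) + 1),
    ∑ ℓ ∈ Finset.univ.erase k,
      (f (t ℓ) - c * ((n₁ : ℝ) - (((ℓ : ℕ) : ℝ) + 1) + 1) * t ℓ),
    ∑ ℓ ∈ Finset.univ.erase k, t ℓ, fun s => ?_⟩
  have hne : ∀ ℓ ∈ Finset.univ.erase k, Function.update t k s ℓ = t ℓ := fun ℓ hℓ =>
    Function.update_of_ne (Finset.ne_of_mem_erase hℓ) _ _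
  unfold finiteHorizonReward
  rw [← Finset.add_sum_erase _ _ (Finset.mem_univ k),
    ← Finset.add_sum_erase _ (Function.update t k s) (Finset.mem_univ k),
    Finset.sum_congr rfl hne,
    Finset.sum_congr rfl fun ℓ hℓ => by rw [hne ℓ hℓ], Function.update_self]

/-- **Second-order necessary condition (Lemma 2, part 4).**
If `t†` is a local maximum point of the finite-horizon reward `J` on `[0,∞)^N`
and `t† k > 0` for some index `k`, then `f'' (t† k) ≤ c λ`. -/
theorem second_order_necessary_condition
    (f f' f'' : ℝ → ℝ)
    (hder1 : ∀ t ∈ Set.Ici (0 : ℝ), HasDerivWithinAt f (f' t) (Set.Ici 0) t)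
    (hder2 : ∀ t ∈ Set.Ici (0 : ℝ), HasDerivWithinAt f' (f'' t) (Set.Ici 0) t)
    (N : ℕ) (hN : 1 ≤ N) (c lam : ℝ) (hc : 0 < c) (hlam : 0 < lam) (n₁ : ℕ)
    (tdag : Fin N → ℝ) (htdag : ∀ i, 0 ≤ tdag i)
    (hlocmax : IsLocalMaxOn (finiteHorizonReward f N c lam n₁)
      {t : Fin N → ℝ | ∀ i, 0 ≤ t i} tdag)
    (k : Fin N) (hk : 0 < tdag k) :
    f'' (tdag k) ≤ c * lam := by
  obtain ⟨b, C, S, hJ⟩ := finiteHorizonReward_update f N c lam n₁ tdag k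
  have hNpos : (0 : ℝ) < 1 / (N : ℝ) := by
    have : (0 : ℝ) < N := by exact_mod_cast hN
    positivity
  have hmax : IsLocalMax
      (fun s => (1 / (N : ℝ)) * (f s - b * s + C - (c * lam / 2) * (s + S) ^ 2)) (tdag k) := by
    have htendsto : Filter.Tendsto (fun s => Function.update tdag k s) (nhds (tdag k))
        (nhdsWithin tdag {t : Fin N → ℝ | ∀ i, 0 ≤ t i}) := by
      refine tendsto_nhdsWithin_iff.2 ⟨?_, ?_⟩
      · have hcont : Continuous fun s : ℝ => Function.update tdag k s :=
          continuous_const.update k continuous_id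
        simpa using hcont.tendsto (tdag k)
      · filter_upwards [lt_mem_nhds hk] with s hs i
        rcases eq_or_ne i k with rfl | hi
        · simpa using hs.le
        · simpa [hi] using htdag i
    filter_upwards [htendsto.eventually hlocmax] with s hs
    rw [← hJ, ← hJ, Function.update_eq_self]
    exact hs
  have hderiv : ∀ᶠ s in nhds (tdag k), HasDerivAt
      (fun s => (1 / (N : ℝ)) * (f s - b * s + C - (c * lam / 2) * (s + S) ^ 2))
      ((1 / (N : ℝ)) * (f' s - b - c * lam * (s + S))) s := by
    filter_upwards [lt_mem_nhds hk] with s hs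
    have hf : HasDerivAt f (f' s) s := (hder1 s hs.le).hasDerivAt (Ici_mem_nhds hs)
    have hsq := (((hasDerivAt_id' s).add_const S).pow 2).const_mul (c * lam / 2)
    have hlin := (hasDerivAt_id' s).const_mul b
    refine ((((hf.sub hlin).add_const C).sub hsq).const_mul (1 / (N : ℝ))).congr_deriv ?_
    push_cast
    ring
  have hderiv' : HasDerivAt (fun s => (1 / (N : ℝ)) * (f' s - b - c * lam * (s + S)))
      ((1 / (N : ℝ)) * (f'' (tdag k) - c * lam)) (tdag k) := by
    have hf' : HasDerivAt f' (f'' (tdag k)) (tdag k) :=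
      (hder2 _ hk.le).hasDerivAt (Ici_mem_nhds hk)
    have hlin := ((hasDerivAt_id' (tdag k)).add_const S).const_mul (c * lam)
    refine (((hf'.sub_const b).sub hlin).const_mul (1 / (N : ℝ))).congr_deriv ?_
    ring
  exact sub_nonpos.1 (nonpos_of_mul_nonpos_right (hmax.second_deriv_nonpos hderiv hderiv') hNpos)
end
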